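/- arXiv:2312.15294 — 2 statements merged into one kernel-verified Lean document; each statement's English description precedes it below -/
import Mathlib

section
/- Let ρ be a real-valued radial neutral Schwartz function on ℝ², let m > 0, I > 0, let v ∈ ℝ² with |v| < 1 and ω ∈ ℝ, and set P = P_{v,ω} and M = M_{v,ω}. Then for all Schwartz vector fields a, π : ℝ² → ℝ² with div a = 0 and div π = 0, one has H_{P,M}(A_{v,ω}+a, Π_{v,ω}+π) − H_{P,M}(A_{v,ω}, Π_{v,ω}) ≥ ((1−|v|)/2)·(∫_{ℝ²}|∇a(y)|² dy + ∫_{ℝ²}|π(y)|² dy), where |∇a|² = Σ_{i,j}(∂_i a_j)². (The soliton is a strict global minimizer of the reduced Hamiltonian.) -/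
open MeasureTheory
open scoped RealInnerProductSpace BigOperators

noncomputable section

abbrev V2 : Type := EuclideanSpace ℝ (Fin 2)

/-- standard basis vector of ℝ² -/
def e2 (j : Fin 2) : V2 := EuclideanSpace.single j 1

/-- Fourier transform with normalization `(2π)⁻¹ ∫ e^{-ik·x} ρ(x) dx`. -/
def FT (ρ : V2 → ℝ) (k : V2) : ℂ :=
  ((2 * Real.pi : ℝ) : ℂ)⁻¹ * ∫ x : V2, Complex.exp (-Complex.I * ((⟪k, x⟫ : ℝ) : ℂ)) * (ρ x : ℂ)

/-- j-th partial derivative of a complex-valued function on ℝ². -/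
def pd (f : V2 → ℂ) (j : Fin 2) (k : V2) : ℂ := fderiv ℝ f k (e2 j)

/-- `|∇f(k)|²` for a complex-valued function on ℝ². -/
def gradNormSqC (f : V2 → ℂ) (k : V2) : ℝ := ∑ j, ‖pd f j k‖ ^ 2

/-- `D(k) = |k|² - (v·k)²`. -/
def Dv (v : V2) (k : V2) : ℝ := ‖k‖ ^ 2 - (⟪v, k⟫ : ℝ) ^ 2

/-- `(J ∇f)_j` where `J` has rows `(0,1)`, `(-1,0)`. -/
def Jgrad (f : V2 → ℂ) (j : Fin 2) (k : V2) : ℂ := ![pd f 1 k, -pd f 0 k] j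

/-- Fourier transform of the soliton field `A_{v,ω}`. -/
def Ahat (ρ : V2 → ℝ) (v : V2) (ω : ℝ) (j : Fin 2) (k : V2) : ℂ :=
  (((v j - k j * (⟪v, k⟫ : ℝ) / ‖k‖ ^ 2 : ℝ) : ℂ) * FT ρ k
      - Complex.I * (ω : ℂ) * Jgrad (FT ρ) j k) / ((Dv v k : ℝ) : ℂ)

/-- The soliton field `A_{v,ω}` (inverse Fourier transform of `Ahat`). -/
def Asol (ρ : V2 → ℝ) (v : V2) (ω : ℝ) (j : Fin 2) (y : V2) : ℝ :=
  (((2 * Real.pi : ℝ) : ℂ)⁻¹ *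
    ∫ k : V2, Complex.exp (Complex.I * ((⟪k, y⟫ : ℝ) : ℂ)) * Ahat ρ v ω j k).re

/-- The soliton field `Π_{v,ω} = -(v·∇) A_{v,ω}`. -/
def Pisol (ρ : V2 → ℝ) (v : V2) (ω : ℝ) (j : Fin 2) (y : V2) : ℝ :=
  - fderiv ℝ (Asol ρ v ω j) y v

/-- `|∇A(y)|² = ∑_{i,j} (∂_i A_j(y))²`. -/
def gradSq (A : Fin 2 → V2 → ℝ) (y : V2) : ℝ :=
  ∑ i, ∑ j, (fderiv ℝ (A j) y (e2 i)) ^ 2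

/-- Field energy `½∫ (|Π|² + |∇A|²)`. -/
def fieldEnergy (A Pf : Fin 2 → V2 → ℝ) : ℝ :=
  (1 / 2) * ∫ y : V2, ((∑ j, (Pf j y) ^ 2) + gradSq A y)

/-- `⟨Π, ∇_* A⟩_j = ∫ Π(y)·∂_j A(y) dy`. -/
def momTerm (A Pf : Fin 2 → V2 → ℝ) (j : Fin 2) : ℝ :=
  ∫ y : V2, ∑ l, Pf l y * fderiv ℝ (A l) y (e2 j)

/-- `⟨A, ρ⟩_j = ∫ A_j(y) ρ(y) dy`. -/
def chargeTerm (ρ : V2 → ℝ) (A : Fin 2 → V2 → ℝ) (j : Fin 2) : ℝ :=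
  ∫ y : V2, A j y * ρ y

/-- `∫ (Jy)·A(y) ρ(y) dy` where `(Jy) = (y₂, -y₁)`. -/
def angTerm (ρ : V2 → ℝ) (A : Fin 2 → V2 → ℝ) : ℝ :=
  ∫ y : V2, (y 1 * A 0 y - y 0 * A 1 y) * ρ y

/-- The reduced Hamiltonian `H_{P,M}(A,Π)`. -/
def Hred (m I : ℝ) (ρ : V2 → ℝ) (P : Fin 2 → ℝ) (M : ℝ) (A Pf : Fin 2 → V2 → ℝ) : ℝ :=
  fieldEnergy A Pf
    + (1 / (2 * m)) * ∑ j, (P j + momTerm A Pf j - chargeTerm ρ A j) ^ 2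
    + (1 / (2 * I)) * (M + angTerm ρ A) ^ 2

/-- The soliton linear momentum `P_{v,ω}`. -/
def Psol (ρ : V2 → ℝ) (m : ℝ) (v : V2) (ω : ℝ) (j : Fin 2) : ℝ :=
  m * v j - momTerm (Asol ρ v ω) (Pisol ρ v ω) j + chargeTerm ρ (Asol ρ v ω) j

/-- The soliton angular momentum `M_{v,ω}`. -/
def Msol (ρ : V2 → ℝ) (I : ℝ) (v : V2) (ω : ℝ) : ℝ :=
  I * ω - angTerm ρ (Asol ρ v ω)

section FourierLemmas
open FourierTransform

variable {V : Type*} [NormedAddCommGroup V] [InnerProductSpace ℝ V] [FiniteDimensional ℝ V]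
  [MeasurableSpace V] [BorelSpace V]

/-- The Fourier integral is self-adjoint on integrable functions. -/
theorem integral_fourier_mul_of_integrable {f g : V → ℂ} (hf : Integrable f) (hg : Integrable g) :
    ∫ ξ, 𝓕 f ξ * g ξ = ∫ x, f x * 𝓕 g x := by
  simpa using! VectorFourier.integral_fourierIntegral_smul_eq_flip (L := innerₗ V)
    Real.continuous_fourierChar continuous_inner hf hg

theorem continuous_fourier_of_integrable {f : V → ℂ} (hf : Integrable f) : Continuous (𝓕 f) :=
  VectorFourier.fourierIntegral_continuous Real.continuous_fourierChar
    (L := innerₗ V) continuous_inner hf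

theorem norm_fourier_le_integral (f : V → ℂ) (x : V) : ‖𝓕 f x‖ ≤ ∫ y, ‖f y‖ :=
  VectorFourier.norm_fourierIntegral_le_integral_norm _ _ _ _ _

/-- The Fourier integral of a function in `L¹ ∩ L²` is square integrable. -/
theorem memLp_two_fourier_of_integrable {f : V → ℂ} (hf : Integrable f) (hf2 : MemLp f 2) :
    MemLp (𝓕 f) 2 := by
  let F : Lp (α := V) ℂ 2 volume := hf2.toLp f
  have hF : MemLp (𝓕 F : Lp (α := V) ℂ 2 volume) 2 := Lp.memLp _
  refine hF.ae_eq (ae_eq_of_integral_contDiff_smul_eq (hF.locallyIntegrable one_le_two)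
    (continuous_fourier_of_integrable hf).locallyIntegrable fun g hg hgc => ?_)
  have hgc' : HasCompactSupport (fun x => (g x : ℂ)) := hgc.comp_left Complex.ofReal_zero
  let φ : SchwartzMap V ℂ := hgc'.toSchwartzMap (Complex.ofRealCLM.contDiff.comp hg)
  have hφ : ∀ x, φ x = (g x : ℂ) := fun x => rfl
  have key := congrArg (fun T => T φ) (Lp.fourier_toTemperedDistribution_eq F)
  simp only [TemperedDistribution.fourier_apply, Lp.toTemperedDistribution_apply] at key
  calc ∫ x, g x • (𝓕 F : Lp (α := V) ℂ 2 volume) x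
      = ∫ x, φ x • (𝓕 F : Lp (α := V) ℂ 2 volume) x := by simp [hφ]
    _ = ∫ x, (𝓕 φ) x • F x := key.symm
    _ = ∫ x, (𝓕 φ) x • f x := by
        refine integral_congr_ae ?_
        filter_upwards [hf2.coeFn_toLp] with x hx
        simp only [F, hx]
    _ = ∫ x, φ x * 𝓕 f x := by
        have := integral_fourier_mul_of_integrable (φ.integrable (μ := volume)) hf
        simpa [SchwartzMap.fourier_coe] using this
    _ = ∫ x, g x • 𝓕 f x := by simp [hφ]

theorem fderiv_fourier_apply {f : V → ℂ} (hf : Integrable f)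
    (hf' : Integrable fun x => ‖x‖ * ‖f x‖) (x u : V) :
    fderiv ℝ (𝓕 f) x u = 𝓕 (fun ξ => -(2 * Real.pi * Complex.I) * ⟪ξ, u⟫ * f ξ) x := by
  have h1 : Integrable (VectorFourier.fourierSMulRight (innerSL ℝ) f) := by
    refine (hf'.const_mul (2 * Real.pi * ‖(innerSL ℝ : V →L[ℝ] V →L[ℝ] ℝ)‖)).mono'
      (hf.aestronglyMeasurable.fourierSMulRight) (.of_forall fun y => ?_)
    exact (VectorFourier.norm_fourierSMulRight_le _ _ _).trans_eq (by ring)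
  rw [Real.fderiv_fourier hf hf', Real.fourier_continuousLinearMap_apply h1]
  refine congrArg (fun g : V → ℂ => 𝓕 g x) (funext fun ξ => ?_)
  simp [VectorFourier.fourierSMulRight_apply, innerSL_apply_apply ℝ]
  ring

/-- A Schwartz function vanishing at the origin is bounded by `C ‖x‖ (1 + ‖x‖ ^ 2) ^ (-2)`. -/
theorem SchwartzMap.exists_norm_le_of_apply_zero {E F : Type*} [NormedAddCommGroup E]
    [NormedSpace ℝ E] [NormedAddCommGroup F] [NormedSpace ℝ F] (f : SchwartzMap E F)
    (hf : f 0 = 0) : ∃ C, 0 ≤ C ∧ ∀ x, ‖f x‖ ≤ C * ‖x‖ * ((1 + ‖x‖ ^ 2) ^ 2)⁻¹ := by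
  obtain ⟨C₁, h₁, hC₁⟩ := f.decay 0 1
  obtain ⟨C₂, h₂, hC₂⟩ := f.decay 4 0
  have hlip : ∀ x, ‖f x‖ ≤ C₁ * ‖x‖ := by
    intro x
    have := Convex.norm_image_sub_le_of_norm_fderiv_le (𝕜 := ℝ) (f := f) (C := C₁) (s := Set.univ)
      (x := 0) (y := x) (fun y _ => f.differentiableAt) (fun y _ => ?_) convex_univ trivial trivial
    · simpa [hf] using this
    · simpa [norm_iteratedFDeriv_one] using hC₁ y
  refine ⟨4 * C₁ + 4 * C₂, by positivity, fun x => ?_⟩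
  have hx := norm_nonneg x
  rw [← div_eq_mul_inv, le_div_iff₀ (by positivity)]
  have hdec : ‖x‖ ^ 4 * ‖f x‖ ≤ C₂ := by simpa using hC₂ x
  rcases le_total ‖x‖ 1 with h | h
  · have : (1 + ‖x‖ ^ 2) ^ 2 ≤ 4 := by
      have h' : ‖x‖ ^ 2 ≤ 1 := pow_le_one₀ hx h
      nlinarith [sq_nonneg ‖x‖]
    calc ‖f x‖ * (1 + ‖x‖ ^ 2) ^ 2 ≤ C₁ * ‖x‖ * 4 := by
          gcongr; exact hlip x
      _ ≤ (4 * C₁ + 4 * C₂) * ‖x‖ := by nlinarith [mul_nonneg h₂.le hx]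
  · have : (1 + ‖x‖ ^ 2) ^ 2 ≤ 4 * ‖x‖ ^ 4 := by
      have h' : 1 ≤ ‖x‖ ^ 2 := one_le_pow₀ h
      nlinarith [sq_nonneg ‖x‖]
    calc ‖f x‖ * (1 + ‖x‖ ^ 2) ^ 2 ≤ ‖f x‖ * (4 * ‖x‖ ^ 4) := by gcongr
      _ ≤ 4 * C₂ * 1 := by nlinarith
      _ ≤ 4 * C₂ * ‖x‖ := by gcongr
      _ ≤ (4 * C₁ + 4 * C₂) * ‖x‖ := by nlinarith [mul_nonneg h₁.le hx]

end FourierLemmas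

section TameSymbols
open FourierTransform LineDeriv

theorem integrable_inv_norm_mul_inv_one_add_sq :
    Integrable fun ξ : V2 => ‖ξ‖⁻¹ * ((1 + ‖ξ‖ ^ 2) ^ 2)⁻¹ := by
  refine (integrable_fun_norm_addHaar volume (f := fun r : ℝ => r⁻¹ * ((1 + r ^ 2) ^ 2)⁻¹)).2 ?_
  refine (integrable_inv_one_add_sq.integrableOn (s := Set.Ioi 0)).mono'
    (by fun_prop) ((ae_restrict_iff' measurableSet_Ioi).2 (.of_forall fun r hr => ?_))
  have hr : (0 : ℝ) < r := hr
  have h1 : (1 : ℝ) ≤ 1 + r ^ 2 := by nlinarith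
  have h2 : 1 + r ^ 2 ≤ (1 + r ^ 2) ^ 2 := by nlinarith
  have h3 : r * (r⁻¹ * ((1 + r ^ 2) ^ 2)⁻¹) = ((1 + r ^ 2) ^ 2)⁻¹ := by
    field_simp
  simp only [finrank_euclideanSpace, Fintype.card_fin, smul_eq_mul, Nat.add_one_sub_one, pow_one]
  rw [h3, Real.norm_of_nonneg (by positivity)]
  exact inv_anti₀ (by positivity) h2

theorem integrable_inv_one_add_norm_sq_sq :
    Integrable fun ξ : V2 => ((1 + ‖ξ‖ ^ 2) ^ 2)⁻¹ := by
  refine (integrable_fun_norm_addHaar volume (f := fun r : ℝ => ((1 + r ^ 2) ^ 2)⁻¹)).2 ?_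
  refine (integrable_inv_one_add_sq.integrableOn (s := Set.Ioi 0)).mono'
    (by fun_prop) ((ae_restrict_iff' measurableSet_Ioi).2 (.of_forall fun r hr => ?_))
  have hr : (0 : ℝ) < r := hr
  simp only [finrank_euclideanSpace, Fintype.card_fin, smul_eq_mul, Nat.add_one_sub_one, pow_one]
  rw [Real.norm_of_nonneg (by positivity), ← div_eq_mul_inv, div_le_iff₀ (by positivity),
    sq (1 + r ^ 2), inv_mul_cancel_left₀ (by positivity)]
  nlinarith [sq_nonneg (r - 1)]

/-- Measurable functions with at most a `‖ξ‖⁻¹` singularity at the origin and fast decay. -/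
structure TameSymbol (G : V2 → ℂ) : Prop where
  aesm : AEStronglyMeasurable G volume
  exists_bound : ∃ C, 0 ≤ C ∧ ∀ ξ, ‖G ξ‖ ≤ C * (‖ξ‖⁻¹ * ((1 + ‖ξ‖ ^ 2) ^ 2)⁻¹)

namespace TameSymbol
variable {G : V2 → ℂ}

theorem integrable (hG : TameSymbol G) : Integrable G := by
  obtain ⟨C, -, hC⟩ := hG.exists_bound
  exact (integrable_inv_norm_mul_inv_one_add_sq.const_mul C).mono' hG.aesm (.of_forall hC)

theorem exists_norm_mul_le (hG : TameSymbol G) :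
    ∃ C, 0 ≤ C ∧ ∀ ξ, ‖ξ‖ * ‖G ξ‖ ≤ C * ((1 + ‖ξ‖ ^ 2) ^ 2)⁻¹ := by
  obtain ⟨C, hC0, hC⟩ := hG.exists_bound
  refine ⟨C, hC0, fun ξ => ?_⟩
  rcases (norm_nonneg ξ).eq_or_lt with h | h
  · rw [← h]; simpa using hC0
  · calc ‖ξ‖ * ‖G ξ‖ ≤ ‖ξ‖ * (C * (‖ξ‖⁻¹ * ((1 + ‖ξ‖ ^ 2) ^ 2)⁻¹)) := by gcongr; exact hC ξ
      _ = C * ((1 + ‖ξ‖ ^ 2) ^ 2)⁻¹ := by field_simp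

theorem integrable_norm_mul (hG : TameSymbol G) : Integrable fun ξ => ‖ξ‖ * ‖G ξ‖ := by
  obtain ⟨C, -, hC⟩ := hG.exists_norm_mul_le
  refine (integrable_inv_one_add_norm_sq_sq.const_mul C).mono'
    (continuous_norm.aestronglyMeasurable.mul hG.aesm.norm) (.of_forall fun ξ => ?_)
  rw [Real.norm_of_nonneg (by positivity)]
  exact hC ξ

/-- The symbol of the derivative in direction `u`. -/
def _root_.derivSymbol (G : V2 → ℂ) (u ξ : V2) : ℂ := -(2 * Real.pi * Complex.I) * ⟪ξ, u⟫ * G ξ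

theorem _root_.norm_derivSymbol_le (G : V2 → ℂ) (u ξ : V2) :
    ‖derivSymbol G u ξ‖ ≤ 2 * Real.pi * ‖u‖ * (‖ξ‖ * ‖G ξ‖) := by
  have := abs_real_inner_le_norm ξ u
  simp only [derivSymbol, norm_mul, norm_neg, Complex.norm_I, Complex.norm_real,
    Complex.norm_ofNat, Real.norm_eq_abs, abs_of_pos Real.pi_pos, mul_one]
  calc 2 * Real.pi * |⟪ξ, u⟫| * ‖G ξ‖ ≤ 2 * Real.pi * (‖ξ‖ * ‖u‖) * ‖G ξ‖ := by gcongr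
    _ = _ := by ring

theorem aestronglyMeasurable_derivSymbol (hG : TameSymbol G) (u : V2) :
    AEStronglyMeasurable (derivSymbol G u) volume := by
  have : Continuous fun ξ : V2 => -(2 * Real.pi * Complex.I) * ((⟪ξ, u⟫ : ℝ) : ℂ) := by fun_prop
  exact this.aestronglyMeasurable.mul hG.aesm

theorem integrable_derivSymbol (hG : TameSymbol G) (u : V2) : Integrable (derivSymbol G u) :=
  (hG.integrable_norm_mul.const_mul _).mono' (hG.aestronglyMeasurable_derivSymbol u)
    (.of_forall (norm_derivSymbol_le G u))

theorem memLp_derivSymbol (hG : TameSymbol G) (u : V2) : MemLp (derivSymbol G u) 2 := by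
  obtain ⟨C, hC0, hC⟩ := hG.exists_norm_mul_le
  obtain ⟨K, hK0, hK⟩ : ∃ K, 0 ≤ K ∧ ∀ ξ, ‖derivSymbol G u ξ‖ ≤ K * ((1 + ‖ξ‖ ^ 2) ^ 2)⁻¹ :=
    ⟨2 * Real.pi * ‖u‖ * C, by positivity, fun ξ => (norm_derivSymbol_le G u ξ).trans (by
      rw [mul_assoc _ C]; exact mul_le_mul_of_nonneg_left (hC ξ) (by positivity))⟩
  have hle : ∀ ξ : V2, ((1 + ‖ξ‖ ^ 2) ^ 2)⁻¹ ≤ 1 := fun ξ =>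
    inv_le_one_of_one_le₀ (one_le_pow₀ (by nlinarith [sq_nonneg ‖ξ‖]))
  rw [memLp_two_iff_integrable_sq_norm (hG.aestronglyMeasurable_derivSymbol u)]
  refine (integrable_inv_one_add_norm_sq_sq.const_mul (K ^ 2)).mono'
    ((hG.aestronglyMeasurable_derivSymbol u).norm.pow 2) (.of_forall fun ξ => ?_)
  rw [Real.norm_of_nonneg (by positivity)]
  have h1 : 0 ≤ ((1 + ‖ξ‖ ^ 2) ^ 2)⁻¹ := by positivity
  calc ‖derivSymbol G u ξ‖ ^ 2 ≤ (K * ((1 + ‖ξ‖ ^ 2) ^ 2)⁻¹) ^ 2 := by gcongr; exact hK ξ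
    _ = K ^ 2 * (((1 + ‖ξ‖ ^ 2) ^ 2)⁻¹ * ((1 + ‖ξ‖ ^ 2) ^ 2)⁻¹) := by ring
    _ ≤ K ^ 2 * (((1 + ‖ξ‖ ^ 2) ^ 2)⁻¹ * 1) := by gcongr; exact hle ξ
    _ = _ := by ring

/-- The real part of the Fourier integral of `G`. -/
def _root_.reFourier (G : V2 → ℂ) (y : V2) : ℝ := (𝓕 G y).re

theorem hasFDerivAt_reFourier (hG : TameSymbol G) (y : V2) :
    HasFDerivAt (reFourier G) (Complex.reCLM ∘L fderiv ℝ (𝓕 G) y) y :=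
  Complex.reCLM.hasFDerivAt.comp y
    (Real.differentiable_fourier hG.integrable hG.integrable_norm_mul y).hasFDerivAt

theorem fderiv_reFourier (hG : TameSymbol G) (y u : V2) :
    fderiv ℝ (reFourier G) y u = reFourier (derivSymbol G u) y := by
  rw [(hG.hasFDerivAt_reFourier y).fderiv]
  rw [ContinuousLinearMap.comp_apply,
    fderiv_fourier_apply hG.integrable hG.integrable_norm_mul]
  rfl

theorem differentiable_reFourier (hG : TameSymbol G) : Differentiable ℝ (reFourier G) :=
  fun y => (hG.hasFDerivAt_reFourier y).differentiableAt

theorem abs_reFourier_le (G : V2 → ℂ) (y : V2) : |reFourier G y| ≤ ∫ ξ, ‖G ξ‖ :=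
  (Complex.abs_re_le_norm _).trans (norm_fourier_le_integral G y)

theorem memLp_fderiv_reFourier (hG : TameSymbol G) (u : V2) :
    MemLp (fun y => fderiv ℝ (reFourier G) y u) 2 := by
  simp only [hG.fderiv_reFourier]
  exact (memLp_two_fourier_of_integrable (hG.integrable_derivSymbol u)
    (hG.memLp_derivSymbol u)).re

/-- The complexification of a real Schwartz function. -/
def _root_.SchwartzMap.complexify (f : SchwartzMap V2 ℝ) : SchwartzMap V2 ℂ :=
  f.postcompCLM Complex.ofRealCLM

@[simp]
theorem _root_.SchwartzMap.complexify_apply (f : SchwartzMap V2 ℝ) (x : V2) :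
    f.complexify x = (f x : ℂ) := rfl

theorem _root_.SchwartzMap.lineDerivOp_complexify_apply (f : SchwartzMap V2 ℝ) (u x : V2) :
    (∂_{u} f.complexify) x = (fderiv ℝ f x u : ℂ) := by
  rw [SchwartzMap.lineDerivOp_apply_eq_fderiv]
  have : HasFDerivAt (f.complexify : V2 → ℂ) (Complex.ofRealCLM ∘L fderiv ℝ f x) x :=
    Complex.ofRealCLM.hasFDerivAt.comp x f.differentiableAt.hasFDerivAt
  rw [this.fderiv]
  rfl

theorem _root_.integral_reFourier_mul {G : V2 → ℂ} (hG : Integrable G) (f : SchwartzMap V2 ℝ) :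
    ∫ y, reFourier G y * f y = (∫ ξ, G ξ * 𝓕 f.complexify ξ).re := by
  have hint : Integrable fun y => 𝓕 G y * f.complexify y :=
    f.complexify.integrable.bdd_mul (continuous_fourier_of_integrable hG).aestronglyMeasurable
      (.of_forall (norm_fourier_le_integral G))
  rw [SchwartzMap.fourier_coe, ← integral_fourier_mul_of_integrable hG f.complexify.integrable]
  refine Eq.trans ?_ (integral_re hint)
  simp [reFourier]

theorem integral_fderiv_reFourier_mul_fderiv (hG : TameSymbol G) (f : SchwartzMap V2 ℝ)
    (u w : V2) :
    ∫ y, fderiv ℝ (reFourier G) y u * fderiv ℝ f y w =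
      (∫ ξ, ((2 * Real.pi) ^ 2 * ⟪ξ, u⟫ * ⟪ξ, w⟫ : ℝ) * (G ξ * 𝓕 f.complexify ξ)).re := by
  have hcx : (∂_{w} f).complexify = ∂_{w} f.complexify := by
    ext x
    rw [SchwartzMap.lineDerivOp_complexify_apply]
    simp [SchwartzMap.lineDerivOp_apply_eq_fderiv]
  have := integral_reFourier_mul (hG.integrable_derivSymbol u) (∂_{w} f)
  simp only [SchwartzMap.lineDerivOp_apply_eq_fderiv, ← hG.fderiv_reFourier] at this
  rw [this, hcx, SchwartzMap.fourier_lineDerivOp_eq]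
  congr 2
  ext ξ
  have hw : (inner ℝ · w : V2 → ℝ).HasTemperateGrowth := by fun_prop
  simp only [derivSymbol, smul_apply, SchwartzMap.smulLeftCLM_apply_apply hw,
    smul_eq_mul, Complex.real_smul]
  push_cast
  linear_combination (-(4 * Real.pi ^ 2 * ⟪ξ, u⟫ * ⟪ξ, w⟫ * G ξ * 𝓕 f.complexify ξ) : ℂ) *
    Complex.I_sq

theorem integrable_reFourier_mul (hG : TameSymbol G) {f : V2 → ℝ} (hf : Integrable f) :
    Integrable fun y => reFourier G y * f y :=
  hf.bdd_mul hG.differentiable_reFourier.continuous.aestronglyMeasurable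
    (.of_forall (abs_reFourier_le G))

end TameSymbol

end TameSymbols

section Minimizer

theorem sum_mul_fderiv_e2 (f : V2 → ℝ) (y v : V2) :
    fderiv ℝ f y v = v 0 * fderiv ℝ f y (e2 0) + v 1 * fderiv ℝ f y (e2 1) := by
  have hv : v = v 0 • e2 0 + v 1 • e2 1 := by
    ext i
    fin_cases i <;> simp [e2]
  conv_lhs => rw [hv]
  simp

theorem sq_fderiv_le (f : V2 → ℝ) (y v : V2) :
    (fderiv ℝ f y v) ^ 2 ≤ ‖v‖ ^ 2 *
      ((fderiv ℝ f y (e2 0)) ^ 2 + (fderiv ℝ f y (e2 1)) ^ 2) := by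
  rw [sum_mul_fderiv_e2, EuclideanSpace.norm_sq_eq, Fin.sum_univ_two]
  simp only [Real.norm_eq_abs, sq_abs]
  nlinarith [sq_nonneg (v 0 * fderiv ℝ f y (e2 1) - v 1 * fderiv ℝ f y (e2 0))]

theorem mul_fderiv_ge (f : V2 → ℝ) (y v : V2) (p : ℝ) :
    -(‖v‖ / 2) * (p ^ 2 + ((fderiv ℝ f y (e2 0)) ^ 2 + (fderiv ℝ f y (e2 1)) ^ 2)) ≤
      p * fderiv ℝ f y v := by
  have h := sq_fderiv_le f y v
  rcases (norm_nonneg v).eq_or_lt with hv | hv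
  · have : v = 0 := norm_eq_zero.1 hv.symm
    simp [this]
  · set d := fderiv ℝ f y v
    set g := (fderiv ℝ f y (e2 0)) ^ 2 + (fderiv ℝ f y (e2 1)) ^ 2
    have : 0 ≤ (‖v‖ * p + d) ^ 2 := sq_nonneg _
    have h2 : 0 ≤ ‖v‖ * (‖v‖ * (p ^ 2 + g) + 2 * (p * d)) := by nlinarith
    have := nonneg_of_mul_nonneg_right h2 hv
    linarith

/-- Completing squares: the increment of the reduced Hamiltonian dominates the increment of the
field energy plus the linear terms coming from the momenta. -/
theorem fieldEnergy_increment_le_Hred_increment {m I : ℝ} (hm : 0 < m) (hI : 0 < I) (ρ : V2 → ℝ)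
    (v : V2) (ω : ℝ) (A Pf B Q : Fin 2 → V2 → ℝ) :
    fieldEnergy B Q - fieldEnergy A Pf
      + ∑ j, v j * ((momTerm B Q j - momTerm A Pf j) - (chargeTerm ρ B j - chargeTerm ρ A j))
      + ω * (angTerm ρ B - angTerm ρ A) ≤
    Hred m I ρ (fun j => m * v j - momTerm A Pf j + chargeTerm ρ A j)
        (I * ω - angTerm ρ A) B Q
      - Hred m I ρ (fun j => m * v j - momTerm A Pf j + chargeTerm ρ A j)
        (I * ω - angTerm ρ A) A Pf := by
  have key : ∀ {c : ℝ}, 0 < c → ∀ x d : ℝ,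
      x * d ≤ 1 / (2 * c) * (c * x + d) ^ 2 - 1 / (2 * c) * (c * x) ^ 2 := by
    intro c hc x d
    have : 1 / (2 * c) * (c * x + d) ^ 2 - 1 / (2 * c) * (c * x) ^ 2 =
        x * d + 1 / (2 * c) * d ^ 2 := by field_simp; ring
    rw [this]
    have : 0 ≤ 1 / (2 * c) * d ^ 2 := by positivity
    linarith
  simp only [Hred, Fin.sum_univ_two]
  have k0 := key hm (v 0) ((momTerm B Q 0 - momTerm A Pf 0) - (chargeTerm ρ B 0 - chargeTerm ρ A 0))
  have k1 := key hm (v 1) ((momTerm B Q 1 - momTerm A Pf 1) - (chargeTerm ρ B 1 - chargeTerm ρ A 1))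
  have k2 := key hI ω (angTerm ρ B - angTerm ρ A)
  ring_nf at k0 k1 k2 ⊢
  linarith

variable {A : Fin 2 → V2 → ℝ} (v : V2) (a p : Fin 2 → SchwartzMap V2 ℝ)

theorem SchwartzMap.memLp_fderiv_apply (f : SchwartzMap V2 ℝ) (u : V2) :
    MemLp (fun y => fderiv ℝ f y u) 2 :=
  (LineDeriv.lineDerivOp u f).memLp 2 volume

/-- The increment of the field energy and of the momentum `v · ⟨Π, ∇_* A⟩` around
`Π = -(v · ∇) A`: the linear part is the weak form of the wave operator, the quadratic part is
coercive. -/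
theorem energy_momentum_increment_ge (hA : ∀ j, Differentiable ℝ (A j))
    (hA2 : ∀ j u, MemLp (fun y => fderiv ℝ (A j) y u) 2) :
    ∑ j, (∑ i, ∫ y, fderiv ℝ (A j) y (e2 i) * fderiv ℝ (a j) y (e2 i)) -
      ∑ j, (∫ y, fderiv ℝ (A j) y v * fderiv ℝ (a j) y v) +
      ((1 - ‖v‖) / 2) *
        ((∫ y : V2, gradSq (fun j => ⇑(a j)) y) + ∫ y : V2, ∑ j, (p j y) ^ 2) ≤
    fieldEnergy (fun j y => A j y + a j y) (fun j y => -fderiv ℝ (A j) y v + p j y) -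
      fieldEnergy A (fun j y => -fderiv ℝ (A j) y v) +
      ∑ j, v j * (momTerm (fun j y => A j y + a j y) (fun j y => -fderiv ℝ (A j) y v + p j y) j -
        momTerm A (fun j y => -fderiv ℝ (A j) y v) j) := by
  have ha2 : ∀ j u, MemLp (fun y => fderiv ℝ (a j) y u) 2 := fun j u =>
    (a j).memLp_fderiv_apply u
  have hp2 : ∀ j, MemLp (fun y => p j y) 2 := fun j => (p j).memLp 2
  have hsum : ∀ j y u, fderiv ℝ (fun y => A j y + a j y) y u =
      fderiv ℝ (A j) y u + fderiv ℝ (a j) y u := fun j y u => by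
    rw [fderiv_fun_add (hA j y) (a j).differentiableAt]; rfl
  have hAa2 : ∀ j u, MemLp (fun y => fderiv ℝ (A j) y u + fderiv ℝ (a j) y u) 2 := fun j u =>
    (hA2 j u).add (ha2 j u)
  have hPp2 : ∀ j, MemLp (fun y => -fderiv ℝ (A j) y v + p j y) 2 := fun j =>
    (hA2 j v).neg.add (hp2 j)
  have hP2 : ∀ j, MemLp (fun y => -fderiv ℝ (A j) y v) 2 := fun j => (hA2 j v).neg
  have i1 : Integrable fun y => (∑ j, (-fderiv ℝ (A j) y v + p j y) ^ 2) +
      gradSq (fun j y => A j y + a j y) y := by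
    simp only [gradSq, hsum]
    exact (integrable_finsetSum _ fun j _ => (hPp2 j).integrable_sq).add
      (integrable_finsetSum _ fun i _ => integrable_finsetSum _ fun j _ =>
        (hAa2 j (e2 i)).integrable_sq)
  have i2 : Integrable fun y => (∑ j, (-fderiv ℝ (A j) y v) ^ 2) + gradSq A y :=
    (integrable_finsetSum _ fun j _ => (hP2 j).integrable_sq).add
      (integrable_finsetSum _ fun i _ => integrable_finsetSum _ fun j _ =>
        (hA2 j (e2 i)).integrable_sq)
  have i3 : ∀ j, Integrable fun y => ∑ l, (-fderiv ℝ (A l) y v + p l y) *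
      fderiv ℝ (fun y => A l y + a l y) y (e2 j) := fun j => by
    simp only [hsum]
    exact integrable_finsetSum _ fun l _ => (hPp2 l).integrable_mul (hAa2 l (e2 j))
  have i4 : ∀ j, Integrable fun y => ∑ l, (-fderiv ℝ (A l) y v) * fderiv ℝ (A l) y (e2 j) :=
    fun j => integrable_finsetSum _ fun l _ => (hP2 l).integrable_mul (hA2 l (e2 j))
  have i5 : ∀ j i, Integrable fun y => fderiv ℝ (A j) y (e2 i) * fderiv ℝ (a j) y (e2 i) :=
    fun j i => (hA2 j (e2 i)).integrable_mul (ha2 j (e2 i))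
  have i6 : ∀ j, Integrable fun y => fderiv ℝ (A j) y v * fderiv ℝ (a j) y v :=
    fun j => (hA2 j v).integrable_mul (ha2 j v)
  have i7 : Integrable fun y => gradSq (fun j => ⇑(a j)) y :=
    integrable_finsetSum _ fun i _ => integrable_finsetSum _ fun j _ =>
      (ha2 j (e2 i)).integrable_sq
  have i8 : Integrable fun y => ∑ j, (p j y) ^ 2 :=
    integrable_finsetSum _ fun j _ => (hp2 j).integrable_sq
  have i5' : Integrable fun y => ∑ j, ∑ i, fderiv ℝ (A j) y (e2 i) * fderiv ℝ (a j) y (e2 i) :=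
    integrable_finsetSum _ fun j _ => integrable_finsetSum _ fun i _ => i5 j i
  have i6' : Integrable fun y => ∑ j, fderiv ℝ (A j) y v * fderiv ℝ (a j) y v :=
    integrable_finsetSum _ fun j _ => i6 j
  simp only [fieldEnergy, momTerm]
  rw [← mul_sub, ← integral_sub i1 i2]
  simp only [← integral_sub (i3 _) (i4 _), ← integral_const_mul]
  have i12 := (i1.sub' i2).const_mul (1 / 2)
  have i34 := fun j => ((i3 j).sub' (i4 j)).const_mul (v j)
  rw [← integral_finsetSum _ fun j _ => i34 j,
    ← integral_add i12 (integrable_finsetSum _ fun j _ => i34 j)]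
  simp only [← integral_finsetSum _ fun i _ => i5 _ i]
  rw [← integral_finsetSum _ fun j _ => integrable_finsetSum _ fun i _ => i5 j i,
    ← integral_finsetSum _ fun j _ => i6 j, ← integral_sub i5' i6', ← integral_add i7 i8,
    ← integral_const_mul, ← integral_add (i5'.sub' i6') ((i7.fun_add i8).const_mul _)]
  refine integral_mono ((i5'.sub' i6').fun_add ((i7.fun_add i8).const_mul _))
    (i12.fun_add (integrable_finsetSum _ fun j _ => i34 j)) fun y => ?_
  have q0 := mul_fderiv_ge (a 0) y v (p 0 y)
  have q1 := mul_fderiv_ge (a 1) y v (p 1 y)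
  simp only [gradSq, hsum, Fin.sum_univ_two]
  simp only [sum_mul_fderiv_e2 _ y v] at q0 q1 ⊢
  linarith

end Minimizer

section Symbol
open FourierTransform LineDeriv

/-- The Schwartz function `x ↦ x_j ρ(x)`. -/
def SchwartzMap.moment (ρ : SchwartzMap V2 ℝ) (j : Fin 2) : SchwartzMap V2 ℝ :=
  SchwartzMap.smulLeftCLM ℝ (fun x : V2 => ⟪x, e2 j⟫) ρ

theorem inner_e2_right (x : V2) (j : Fin 2) : (⟪x, e2 j⟫ : ℝ) = x j := by
  rw [e2, EuclideanSpace.inner_single_right]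
  simp

theorem SchwartzMap.moment_apply (ρ : SchwartzMap V2 ℝ) (j : Fin 2) (x : V2) :
    ρ.moment j x = x j * ρ x := by
  have hw : (inner ℝ · (e2 j) : V2 → ℝ).HasTemperateGrowth := by fun_prop
  rw [SchwartzMap.moment, SchwartzMap.smulLeftCLM_apply_apply hw, inner_e2_right, smul_eq_mul]

/-- The rotational source `x ↦ (J x)_j ρ(x)`. -/
def rotSource (ρ : SchwartzMap V2 ℝ) (j : Fin 2) : SchwartzMap V2 ℝ :=
  ![ρ.moment 1, -ρ.moment 0] j

theorem FT_eq (ρ : SchwartzMap V2 ℝ) (k : V2) :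
    FT ρ k = ((2 * Real.pi : ℝ) : ℂ)⁻¹ * 𝓕⁻ ρ.complexify ((-(2 * Real.pi)⁻¹ : ℝ) • k) := by
  rw [FT, SchwartzMap.fourierInv_coe, Real.fourierInv_eq']
  congr 2
  ext x
  rw [smul_eq_mul, real_inner_smul_right, real_inner_comm, SchwartzMap.complexify_apply]
  congr 2
  push_cast
  have : (Real.pi : ℂ) ≠ 0 := by exact_mod_cast Real.pi_ne_zero
  field_simp

theorem lineDerivOp_fourierInv_e2 (ρ : SchwartzMap V2 ℝ) (j : Fin 2) (x : V2) :
    fderiv ℝ (𝓕⁻ ρ.complexify : SchwartzMap V2 ℂ) x (e2 j) =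
      2 * Real.pi * Complex.I * 𝓕⁻ (ρ.moment j).complexify x := by
  have h : SchwartzMap.smulLeftCLM ℂ (inner ℝ · (e2 j)) ρ.complexify =
      (ρ.moment j).complexify := by
    have hw : (inner ℝ · (e2 j) : V2 → ℝ).HasTemperateGrowth := by fun_prop
    ext y
    rw [SchwartzMap.smulLeftCLM_apply_apply hw]
    simp [SchwartzMap.moment_apply, inner_e2_right]
  rw [← SchwartzMap.lineDerivOp_apply_eq_fderiv, SchwartzMap.lineDerivOp_fourierInv_eq, h,
    FourierTransform.fourierInv_smul]
  simp

theorem pd_FT (ρ : SchwartzMap V2 ℝ) (j : Fin 2) (k : V2) :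
    pd (FT ρ) j k = -Complex.I * ((2 * Real.pi : ℝ) : ℂ)⁻¹ *
      𝓕⁻ (ρ.moment j).complexify ((-(2 * Real.pi)⁻¹ : ℝ) • k) := by
  set c : ℝ := -(2 * Real.pi)⁻¹ with hc
  have h1 : HasFDerivAt (fun k : V2 => c • k) (c • ContinuousLinearMap.id ℝ V2) k :=
    (hasFDerivAt_id k).const_smul c
  have h2 := ((𝓕⁻ ρ.complexify : SchwartzMap V2 ℂ).differentiableAt.hasFDerivAt (x := c • k)).comp
    k h1 |>.const_mul (((2 * Real.pi : ℝ) : ℂ)⁻¹)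
  have h3 : (FT ρ) = fun k => ((2 * Real.pi : ℝ) : ℂ)⁻¹ * 𝓕⁻ ρ.complexify (c • k) :=
    funext (FT_eq ρ)
  rw [pd, h3]
  erw [h2.fderiv]
  simp only [smul_apply, ContinuousLinearMap.comp_apply, map_smul,
    ContinuousLinearMap.id_apply, lineDerivOp_fourierInv_e2, smul_eq_mul, Complex.real_smul]
  have : (Real.pi : ℂ) ≠ 0 := by exact_mod_cast Real.pi_ne_zero
  rw [hc]
  push_cast
  field_simp

theorem Jgrad_FT (ρ : SchwartzMap V2 ℝ) (j : Fin 2) (k : V2) :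
    Jgrad (FT ρ) j k = -Complex.I * ((2 * Real.pi : ℝ) : ℂ)⁻¹ *
      𝓕⁻ (rotSource ρ j).complexify ((-(2 * Real.pi)⁻¹ : ℝ) • k) := by
  have hneg : (-ρ.moment 0).complexify = -(ρ.moment 0).complexify := by
    ext x; simp
  fin_cases j
  · simp [Jgrad, rotSource, pd_FT]
  · simp [Jgrad, rotSource, pd_FT, hneg, FourierTransform.fourierInv_neg]

/-- The soliton field in frequency variables adapted to Mathlib's Fourier integral. -/
def solitonSymbol (ρ : SchwartzMap V2 ℝ) (v : V2) (ω : ℝ) (j : Fin 2) (ξ : V2) : ℂ :=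
  (((v j - ξ j * (⟪v, ξ⟫ : ℝ) / ‖ξ‖ ^ 2 : ℝ) : ℂ) * 𝓕⁻ ρ.complexify ξ
      - (ω : ℂ) * 𝓕⁻ (rotSource ρ j).complexify ξ) / (((2 * Real.pi) ^ 2 * Dv v ξ : ℝ) : ℂ)

theorem Ahat_neg_two_pi_smul (ρ : SchwartzMap V2 ℝ) (v : V2) (ω : ℝ) (j : Fin 2) (ξ : V2) :
    ((2 * Real.pi : ℝ) : ℂ) * Ahat ρ v ω j ((-(2 * Real.pi) : ℝ) • ξ) =
      solitonSymbol ρ v ω j ξ := by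
  have hpi : (Real.pi : ℂ) ≠ 0 := by exact_mod_cast Real.pi_ne_zero
  have h1 : ((-(2 * Real.pi)⁻¹ : ℝ) • (-(2 * Real.pi) : ℝ) • ξ) = ξ := by
    rw [smul_smul, neg_mul_neg, inv_mul_cancel₀ (by positivity), one_smul]
  have h2 : Dv v ((-(2 * Real.pi) : ℝ) • ξ) = (2 * Real.pi) ^ 2 * Dv v ξ := by
    rw [Dv, Dv, norm_smul, real_inner_smul_right, mul_pow, Real.norm_eq_abs, sq_abs]
    ring
  have h3 : ((-(2 * Real.pi) : ℝ) • ξ) j * (⟪v, (-(2 * Real.pi) : ℝ) • ξ⟫ : ℝ) /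
      ‖(-(2 * Real.pi) : ℝ) • ξ‖ ^ 2 = ξ j * (⟪v, ξ⟫ : ℝ) / ‖ξ‖ ^ 2 := by
    rw [norm_smul, real_inner_smul_right, mul_pow, Real.norm_eq_abs, sq_abs, PiLp.smul_apply,
      smul_eq_mul]
    rw [show -(2 * Real.pi) * ξ j * (-(2 * Real.pi) * (⟪v, ξ⟫ : ℝ)) =
      (-(2 * Real.pi)) ^ 2 * (ξ j * (⟪v, ξ⟫ : ℝ)) by ring]
    exact mul_div_mul_left _ _ (by simp [Real.pi_ne_zero])
  rw [Ahat, FT_eq, Jgrad_FT, h1, h2, h3, solitonSymbol, ← mul_div_assoc]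
  congr 1
  push_cast
  field_simp
  linear_combination ((ω : ℂ) * 𝓕⁻ (rotSource ρ j).complexify ξ) * Complex.I_sq

theorem Asol_eq_reFourier (ρ : SchwartzMap V2 ℝ) (v : V2) (ω : ℝ) (j : Fin 2) :
    Asol ρ v ω j = reFourier (solitonSymbol ρ v ω j) := by
  ext y
  rw [Asol, reFourier, Real.fourier_eq']
  have h := Measure.integral_comp_smul (volume : Measure V2)
    (fun k : V2 => Complex.exp (Complex.I * ((⟪k, y⟫ : ℝ) : ℂ)) * Ahat ρ v ω j k)
    (-(2 * Real.pi))
  have hpi : (Real.pi : ℂ) ≠ 0 := by exact_mod_cast Real.pi_ne_zero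
  simp only [finrank_euclideanSpace, Fintype.card_fin, neg_sq] at h
  rw [abs_of_nonneg (by positivity), Complex.real_smul] at h
  congr 1
  calc _ = ((2 * Real.pi : ℝ) : ℂ) * ((((2 * Real.pi) ^ 2)⁻¹ : ℝ) *
        ∫ k : V2, Complex.exp (Complex.I * ((⟪k, y⟫ : ℝ) : ℂ)) * Ahat ρ v ω j k) := by
        push_cast
        field_simp
    _ = _ := by
        rw [← h, ← integral_const_mul]
        congr 1
        ext ξ
        rw [← Ahat_neg_two_pi_smul, real_inner_smul_left, smul_eq_mul]
        push_cast
        ring_nf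

end Symbol

section Soliton
open FourierTransform LineDeriv

theorem fourierInv_apply_zero (f : SchwartzMap V2 ℝ) :
    𝓕⁻ f.complexify 0 = ((∫ x, f x : ℝ) : ℂ) := by
  rw [SchwartzMap.fourierInv_coe, Real.fourierInv_eq']
  simp [integral_complex_ofReal]

theorem integral_moment_eq_zero (ρ : SchwartzMap V2 ℝ) (hrad : ∀ x y : V2, ‖x‖ = ‖y‖ → ρ x = ρ y)
    (j : Fin 2) : ∫ x, ρ.moment j x = 0 := by
  have h := integral_neg_eq_self (fun x => ρ.moment j x) (volume : Measure V2)
  have h2 : (fun x => ρ.moment j (-x)) = fun x => -ρ.moment j x := by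
    ext x
    rw [SchwartzMap.moment_apply, SchwartzMap.moment_apply, hrad (-x) x (norm_neg x)]
    simp
  rw [h2, integral_neg] at h
  linarith

theorem integral_rotSource_eq_zero (ρ : SchwartzMap V2 ℝ)
    (hrad : ∀ x y : V2, ‖x‖ = ‖y‖ → ρ x = ρ y) (j : Fin 2) : ∫ x, rotSource ρ j x = 0 := by
  fin_cases j
  · simpa [rotSource] using integral_moment_eq_zero ρ hrad 1
  · simpa [rotSource, integral_neg] using integral_moment_eq_zero ρ hrad 0

theorem Dv_eq (v ξ : V2) : Dv v ξ = ξ 0 * ξ 0 + ξ 1 * ξ 1 - ⟪ξ, v⟫ * ⟪ξ, v⟫ := by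
  rw [Dv, EuclideanSpace.norm_sq_eq, Fin.sum_univ_two, real_inner_comm]
  simp only [Real.norm_eq_abs, sq_abs]
  ring

theorem Dv_ge (v ξ : V2) : (1 - ‖v‖ ^ 2) * ‖ξ‖ ^ 2 ≤ Dv v ξ := by
  have h := sq_le_sq' (neg_le_of_abs_le (abs_real_inner_le_norm v ξ))
    (le_of_abs_le (abs_real_inner_le_norm v ξ))
  rw [Dv]
  nlinarith

theorem abs_transverse_le {v : V2} (hv : ‖v‖ < 1) (j : Fin 2) (ξ : V2) :
    |v j - ξ j * (⟪v, ξ⟫ : ℝ) / ‖ξ‖ ^ 2| ≤ 2 := by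
  have h1 : |v j| ≤ 1 := (PiLp.norm_apply_le v j).trans hv.le
  have h2 : |ξ j * (⟪v, ξ⟫ : ℝ) / ‖ξ‖ ^ 2| ≤ 1 := by
    rw [abs_div, abs_mul, abs_of_nonneg (sq_nonneg ‖ξ‖)]
    refine div_le_one_of_le₀ ?_ (sq_nonneg _)
    have h3 : |ξ j| ≤ ‖ξ‖ := PiLp.norm_apply_le ξ j
    have h4 : |(⟪v, ξ⟫ : ℝ)| ≤ ‖ξ‖ := (abs_real_inner_le_norm v ξ).trans
      (mul_le_of_le_one_left (norm_nonneg _) hv.le)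
    rw [sq]
    gcongr
  linarith [abs_sub (v j) (ξ j * (⟪v, ξ⟫ : ℝ) / ‖ξ‖ ^ 2)]

/-- Neutrality and radial symmetry make the soliton symbol only mildly singular at the origin. -/
theorem tameSymbol_solitonSymbol (ρ : SchwartzMap V2 ℝ)
    (hrad : ∀ x y : V2, ‖x‖ = ‖y‖ → ρ x = ρ y) (hneu : ∫ x, ρ x = 0) {v : V2} (hv : ‖v‖ < 1)
    (ω : ℝ) (j : Fin 2) : TameSymbol (solitonSymbol ρ v ω j) := by
  constructor
  · have hR : Measurable (𝓕⁻ ρ.complexify : SchwartzMap V2 ℂ) :=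
      (SchwartzMap.continuous _).measurable
    have hS : Measurable (𝓕⁻ (rotSource ρ j).complexify : SchwartzMap V2 ℂ) :=
      (SchwartzMap.continuous _).measurable
    have hD : Measurable (Dv v) := by unfold Dv; fun_prop
    have hc : Measurable fun ξ : V2 => v j - ξ j * (⟪v, ξ⟫ : ℝ) / ‖ξ‖ ^ 2 := by fun_prop
    refine Measurable.aestronglyMeasurable ?_
    unfold solitonSymbol
    fun_prop
  · obtain ⟨C, hC0, hC⟩ := SchwartzMap.exists_norm_le_of_apply_zero
      (𝓕⁻ ρ.complexify : SchwartzMap V2 ℂ) (by rw [fourierInv_apply_zero, hneu]; simp)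
    obtain ⟨K, hK0, hK⟩ := SchwartzMap.exists_norm_le_of_apply_zero
      (𝓕⁻ (rotSource ρ j).complexify : SchwartzMap V2 ℂ)
      (by rw [fourierInv_apply_zero, integral_rotSource_eq_zero ρ hrad]; simp)
    have hv2 : 0 < 1 - ‖v‖ ^ 2 := by nlinarith [norm_nonneg v]
    refine ⟨(2 * C + |ω| * K) / ((2 * Real.pi) ^ 2 * (1 - ‖v‖ ^ 2)), by positivity, fun ξ => ?_⟩
    rcases (norm_nonneg ξ).eq_or_lt with h | h
    · have : ξ = 0 := norm_eq_zero.1 h.symm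
      simp [solitonSymbol, this, Dv]
    have hD : 0 < (1 - ‖v‖ ^ 2) * ‖ξ‖ ^ 2 := by positivity
    have hnum : ‖((v j - ξ j * (⟪v, ξ⟫ : ℝ) / ‖ξ‖ ^ 2 : ℝ) : ℂ) * 𝓕⁻ ρ.complexify ξ
        - (ω : ℂ) * 𝓕⁻ (rotSource ρ j).complexify ξ‖ ≤
        (2 * C + |ω| * K) * (‖ξ‖ * ((1 + ‖ξ‖ ^ 2) ^ 2)⁻¹) := by
      refine (norm_sub_le _ _).trans ?_
      rw [norm_mul, norm_mul, Complex.norm_real, Complex.norm_real, Real.norm_eq_abs,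
        Real.norm_eq_abs]
      calc _ ≤ 2 * (C * ‖ξ‖ * ((1 + ‖ξ‖ ^ 2) ^ 2)⁻¹) +
            |ω| * (K * ‖ξ‖ * ((1 + ‖ξ‖ ^ 2) ^ 2)⁻¹) := by
            gcongr
            · exact abs_transverse_le hv j ξ
            · exact hC ξ
            · exact hK ξ
        _ = _ := by ring
    have hden : (2 * Real.pi) ^ 2 * ((1 - ‖v‖ ^ 2) * ‖ξ‖ ^ 2) ≤
        ‖(((2 * Real.pi) ^ 2 * Dv v ξ : ℝ) : ℂ)‖ := by
      rw [Complex.norm_real, Real.norm_eq_abs]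
      refine le_trans ?_ (le_abs_self _)
      gcongr
      exact Dv_ge v ξ
    rw [solitonSymbol, norm_div]
    calc _ ≤ (2 * C + |ω| * K) * (‖ξ‖ * ((1 + ‖ξ‖ ^ 2) ^ 2)⁻¹) /
          ((2 * Real.pi) ^ 2 * ((1 - ‖v‖ ^ 2) * ‖ξ‖ ^ 2)) := by gcongr
      _ = _ := by field_simp

theorem TameSymbol.integrable_mul_schwartz {G : V2 → ℂ} (hG : TameSymbol G)
    (g : SchwartzMap V2 ℂ) (u w : V2) :
    Integrable fun ξ => (((2 * Real.pi) ^ 2 * ⟪ξ, u⟫ * ⟪ξ, w⟫ : ℝ) : ℂ) * (G ξ * g ξ) := by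
  obtain ⟨C, hC0, hC⟩ := g.decay 1 0
  have hc : Continuous fun ξ : V2 => (((2 * Real.pi) ^ 2 * ⟪ξ, u⟫ * ⟪ξ, w⟫ : ℝ) : ℂ) := by
    fun_prop
  refine (hG.integrable_norm_mul.const_mul ((2 * Real.pi) ^ 2 * ‖u‖ * ‖w‖ * C)).mono'
    (hc.aestronglyMeasurable.mul (hG.aesm.mul g.continuous.aestronglyMeasurable))
    (.of_forall fun ξ => ?_)
  have h1 := abs_real_inner_le_norm ξ u
  have h2 := abs_real_inner_le_norm ξ w
  have h3 : ‖ξ‖ * ‖g ξ‖ ≤ C := by simpa using hC ξ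
  rw [norm_mul, norm_mul, Complex.norm_real, Real.norm_eq_abs, abs_mul, abs_mul, abs_sq]
  calc _ ≤ (2 * Real.pi) ^ 2 * (‖ξ‖ * ‖u‖) * (‖ξ‖ * ‖w‖) * (‖G ξ‖ * ‖g ξ‖) := by gcongr
    _ = (2 * Real.pi) ^ 2 * ‖u‖ * ‖w‖ * (‖ξ‖ * ‖g ξ‖) * (‖ξ‖ * ‖G ξ‖) := by ring
    _ ≤ _ := by gcongr

theorem sum_mul_fourier_eq_zero (a : Fin 2 → SchwartzMap V2 ℝ)
    (hdiv : ∀ y : V2, (∑ j, fderiv ℝ (⇑(a j)) y (e2 j)) = 0) (ξ : V2) :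
    ∑ j, (ξ j : ℂ) * 𝓕 (a j).complexify ξ = 0 := by
  have h0 : ∑ j, ∂_{e2 j} (a j).complexify = 0 := by
    ext y
    have := congrArg (fun x : ℝ => (x : ℂ)) (hdiv y)
    simpa [SchwartzMap.lineDerivOp_complexify_apply] using this
  have h1 : ∀ j, 𝓕 (∂_{e2 j} (a j).complexify) ξ =
      2 * Real.pi * Complex.I * ((ξ j : ℂ) * 𝓕 (a j).complexify ξ) := by
    intro j
    have hw : (inner ℝ · (e2 j) : V2 → ℝ).HasTemperateGrowth := by fun_prop
    rw [SchwartzMap.fourier_lineDerivOp_eq]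
    rw [smul_apply, SchwartzMap.smulLeftCLM_apply_apply hw, inner_e2_right]
    rfl
  have h2 : 𝓕 (∑ j, ∂_{e2 j} (a j).complexify) ξ = 0 := by
    rw [h0, FourierTransform.fourier_zero]; rfl
  rw [Fin.sum_univ_two, FourierTransform.fourier_add, add_apply, h1, h1, ← mul_add] at h2
  rw [Fin.sum_univ_two]
  exact (mul_eq_zero.1 h2).resolve_left (by simp [Real.pi_ne_zero])

/-- The soliton field is a weak solution of the elliptic equation obtained by inserting the
travelling wave ansatz into the wave equation, tested against divergence free fields. -/
theorem weak_soliton_equation (ρ : SchwartzMap V2 ℝ)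
    (hrad : ∀ x y : V2, ‖x‖ = ‖y‖ → ρ x = ρ y) (hneu : ∫ x, ρ x = 0) {v : V2} (hv : ‖v‖ < 1)
    (ω : ℝ) (a : Fin 2 → SchwartzMap V2 ℝ)
    (hdiv : ∀ y : V2, (∑ j, fderiv ℝ (⇑(a j)) y (e2 j)) = 0) :
    ∑ j, (∑ i, ∫ y, fderiv ℝ (Asol ρ v ω j) y (e2 i) * fderiv ℝ (a j) y (e2 i)) -
      ∑ j, (∫ y, fderiv ℝ (Asol ρ v ω j) y v * fderiv ℝ (a j) y v) =
    ∑ j, ∫ y, (v j * ρ y - ω * rotSource ρ j y) * a j y := by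
  have hT := tameSymbol_solitonSymbol ρ hrad hneu hv ω
  have hv2 : 0 < 1 - ‖v‖ ^ 2 := by nlinarith [norm_nonneg v]
  let s : Fin 2 → SchwartzMap V2 ℂ := fun j =>
    (v j : ℂ) • ρ.complexify + (-ω : ℂ) • (rotSource ρ j).complexify
  have hs : ∀ j ξ, 𝓕⁻ (s j) ξ = (v j : ℂ) * 𝓕⁻ ρ.complexify ξ -
      (ω : ℂ) * 𝓕⁻ (rotSource ρ j).complexify ξ := fun j ξ => by
    simp only [s, FourierTransform.fourierInv_add, FourierTransform.fourierInv_smul,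
      add_apply, smul_apply, smul_eq_mul]
    ring
  have hrhs : ∀ j, ∫ y, (v j * ρ y - ω * rotSource ρ j y) * a j y =
      (∫ ξ, 𝓕⁻ (s j) ξ * 𝓕 (a j).complexify ξ).re := fun j => by
    rw [SchwartzMap.integral_fourierInv_mul_eq, FourierTransform.fourierInv_fourier_eq,
      ← Complex.ofReal_re (∫ y, (v j * ρ y - ω * rotSource ρ j y) * a j y),
      ← integral_complex_ofReal]
    congr 2
    ext y
    simp [s, sub_eq_add_neg]
  have hint := fun j => (hT j).integrable_mul_schwartz (𝓕 (a j).complexify)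
  have hlhs : ∀ j, (∑ i, ∫ y, fderiv ℝ (Asol ρ v ω j) y (e2 i) * fderiv ℝ (a j) y (e2 i)) -
      (∫ y, fderiv ℝ (Asol ρ v ω j) y v * fderiv ℝ (a j) y v) =
      (∫ ξ, (((2 * Real.pi) ^ 2 * Dv v ξ : ℝ) : ℂ) *
        (solitonSymbol ρ v ω j ξ * 𝓕 (a j).complexify ξ)).re := fun j => by
    simp only [Asol_eq_reFourier, (hT j).integral_fderiv_reFourier_mul_fderiv, Fin.sum_univ_two]
    rw [← Complex.add_re, ← Complex.sub_re, ← integral_add (hint j _ _) (hint j _ _),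
      ← integral_sub ((hint j _ _).fun_add (hint j _ _)) (hint j _ _)]
    congr 2
    ext ξ
    simp only [inner_e2_right, Dv_eq]
    push_cast
    ring
  have hlint : ∀ j, Integrable fun ξ => (((2 * Real.pi) ^ 2 * Dv v ξ : ℝ) : ℂ) *
        (solitonSymbol ρ v ω j ξ * 𝓕 (a j).complexify ξ) := fun j => by
    refine (((hint j (e2 0) (e2 0)).fun_add (hint j (e2 1) (e2 1))).sub' (hint j v v)).congr
      (.of_forall fun ξ => ?_)
    simp only [inner_e2_right, Dv_eq]
    push_cast
    ring
  have hrint : ∀ j, Integrable fun ξ => 𝓕⁻ (s j) ξ * 𝓕 (a j).complexify ξ := fun j =>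
    ((𝓕⁻ (s j)).memLp 2 volume).integrable_mul ((𝓕 (a j).complexify).memLp 2 volume)
  rw [← Finset.sum_sub_distrib]
  simp only [hlhs, hrhs, ← Complex.re_sum]
  rw [← integral_finsetSum _ fun j _ => hlint j, ← integral_finsetSum _ fun j _ => hrint j]
  congr 1
  refine integral_congr_ae ?_
  filter_upwards [compl_mem_ae_iff.2 (measure_singleton (0 : V2))] with ξ hξ
  have hξ : 0 < ‖ξ‖ := norm_pos_iff.2 hξ
  have hD : (2 * Real.pi) ^ 2 * Dv v ξ ≠ 0 :=
    mul_ne_zero (by positivity) ((mul_pos hv2 (by positivity)).trans_le (Dv_ge v ξ)).ne'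
  have hz := sum_mul_fourier_eq_zero a hdiv ξ
  have hsym : ∀ j, (((2 * Real.pi) ^ 2 * Dv v ξ : ℝ) : ℂ) *
        (solitonSymbol ρ v ω j ξ * 𝓕 (a j).complexify ξ) =
      𝓕⁻ (s j) ξ * 𝓕 (a j).complexify ξ -
        ((⟪v, ξ⟫ / ‖ξ‖ ^ 2 : ℝ) : ℂ) * 𝓕⁻ ρ.complexify ξ *
          ((ξ j : ℂ) * 𝓕 (a j).complexify ξ) := fun j => by
    rw [solitonSymbol, ← mul_assoc, mul_div_cancel₀ _ (Complex.ofReal_ne_zero.2 hD), hs]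
    push_cast
    ring
  simp only [hsym]
  rw [Finset.sum_sub_distrib, ← Finset.mul_sum, hz, mul_zero, sub_zero]

end Soliton

section Sources

theorem SchwartzMap.integrable_mul (f g : SchwartzMap V2 ℝ) : Integrable fun y => f y * g y :=
  (f.memLp 2 volume).integrable_mul (g.memLp 2 volume)

theorem sum_integral_source_mul (ρ : SchwartzMap V2 ℝ) (v : V2) (ω : ℝ)
    (a : Fin 2 → SchwartzMap V2 ℝ) :
    ∑ j, ∫ y, (v j * ρ y - ω * rotSource ρ j y) * a j y =
      ∑ j, v j * chargeTerm ρ (fun j => ⇑(a j)) j - ω * angTerm ρ (fun j => ⇑(a j)) := by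
  have h1 : ∀ j, ∫ y, (v j * ρ y - ω * rotSource ρ j y) * a j y =
      v j * chargeTerm ρ (fun j => ⇑(a j)) j - ω * ∫ y, rotSource ρ j y * a j y := fun j => by
    rw [chargeTerm, ← integral_const_mul, ← integral_const_mul, ← integral_sub
      (((a j).integrable_mul ρ).const_mul _) (((rotSource ρ j).integrable_mul (a j)).const_mul _)]
    congr 1
    ext y
    ring
  have h2 : angTerm ρ (fun j => ⇑(a j)) = ∑ j, ∫ y, rotSource ρ j y * a j y := by
    rw [angTerm, ← integral_finsetSum _ fun j _ => (rotSource ρ j).integrable_mul (a j)]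
    congr 1
    ext y
    simp [rotSource, SchwartzMap.moment_apply]
    ring
  simp only [h1, h2, Finset.sum_sub_distrib, Finset.mul_sum]

theorem chargeTerm_add_sub (ρ : SchwartzMap V2 ℝ) {A : Fin 2 → V2 → ℝ}
    (a : Fin 2 → SchwartzMap V2 ℝ) (j : Fin 2) (hA : Integrable fun y => A j y * ρ y) :
    chargeTerm ρ (fun j y => A j y + a j y) j - chargeTerm ρ A j =
      chargeTerm ρ (fun j => ⇑(a j)) j := by
  simp only [chargeTerm, add_mul]
  rw [integral_add hA ((a j).integrable_mul ρ), add_sub_cancel_left]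

theorem angTerm_add_sub (ρ : SchwartzMap V2 ℝ) {A : Fin 2 → V2 → ℝ}
    (a : Fin 2 → SchwartzMap V2 ℝ)
    (hA : ∀ j (f : SchwartzMap V2 ℝ), Integrable fun y => A j y * f y) :
    angTerm ρ (fun j y => A j y + a j y) - angTerm ρ A = angTerm ρ (fun j => ⇑(a j)) := by
  have key : ∀ B : Fin 2 → V2 → ℝ, angTerm ρ B =
      ∫ y, (B 0 y * ρ.moment 1 y - B 1 y * ρ.moment 0 y) := fun B => by
    rw [angTerm]
    congr 1
    ext y
    rw [SchwartzMap.moment_apply, SchwartzMap.moment_apply]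
    ring
  rw [key, key, key, ← integral_sub _ ((hA 0 _).sub' (hA 1 _))]
  · congr 1
    ext y
    ring
  · simp only [add_mul]
    exact ((hA 0 _).fun_add ((a 0).integrable_mul _)).sub'
      ((hA 1 _).fun_add ((a 1).integrable_mul _))

end Sources

/-- the soliton is a strict global minimizer of the reduced Hamiltonian:
lower bound for the increment of `H_{P,M}` at the soliton, for solenoidal Schwartz
perturbations. -/
theorem soliton_global_minimizer
    (ρ : SchwartzMap V2 ℝ)
    (hrad : ∀ x y : V2, ‖x‖ = ‖y‖ → ρ x = ρ y)
    (hneu : (∫ x : V2, ρ x) = 0)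
    (m I : ℝ) (hm : 0 < m) (hI : 0 < I)
    (v : V2) (hv : ‖v‖ < 1) (ω : ℝ)
    (a π : Fin 2 → SchwartzMap V2 ℝ)
    (hdiva : ∀ y : V2, (∑ j, fderiv ℝ (⇑(a j)) y (e2 j)) = 0)
    (hdivπ : ∀ y : V2, (∑ j, fderiv ℝ (⇑(π j)) y (e2 j)) = 0) :
    Hred m I (⇑ρ) (Psol (⇑ρ) m v ω) (Msol (⇑ρ) I v ω)
        (fun j y => Asol (⇑ρ) v ω j y + a j y)
        (fun j y => Pisol (⇑ρ) v ω j y + π j y)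
      - Hred m I (⇑ρ) (Psol (⇑ρ) m v ω) (Msol (⇑ρ) I v ω)
        (Asol (⇑ρ) v ω) (Pisol (⇑ρ) v ω)
      ≥ ((1 - ‖v‖) / 2) *
        ((∫ y : V2, gradSq (fun j => ⇑(a j)) y) + ∫ y : V2, ∑ j, (π j y) ^ 2) := by
  have hT := tameSymbol_solitonSymbol ρ hrad hneu hv ω
  have hA : ∀ j, Differentiable ℝ (Asol ρ v ω j) := fun j => by
    rw [Asol_eq_reFourier]
    exact (hT j).differentiable_reFourier
  have hA2 : ∀ j u, MemLp (fun y => fderiv ℝ (Asol ρ v ω j) y u) 2 := fun j u => by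
    rw [Asol_eq_reFourier]
    exact (hT j).memLp_fderiv_reFourier u
  have hAint : ∀ j (f : SchwartzMap V2 ℝ), Integrable fun y => Asol ρ v ω j y * f y :=
    fun j f => by
      rw [Asol_eq_reFourier]
      exact (hT j).integrable_reFourier_mul f.integrable
  have h1 := fieldEnergy_increment_le_Hred_increment hm hI ρ v ω (Asol ρ v ω) (Pisol ρ v ω)
    (fun j y => Asol ρ v ω j y + a j y) (fun j y => Pisol ρ v ω j y + π j y)
  have h2 := energy_momentum_increment_ge v a π hA hA2
  rw [weak_soliton_equation ρ hrad hneu hv ω a hdiva, sum_integral_source_mul] at h2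
  rw [angTerm_add_sub ρ a hAint] at h1
  simp only [chargeTerm_add_sub ρ a _ (hAint _ ρ), mul_sub (v _), Finset.sum_sub_distrib] at h1
  have hPi : ∀ j y, -fderiv ℝ (Asol ρ v ω j) y v = Pisol ρ v ω j y := fun _ _ => rfl
  simp only [hPi, mul_sub (v _), Finset.sum_sub_distrib] at h2
  exact ge_iff_le.2 (le_trans (by linarith [h2]) h1)

end
end

section
/- Let ρ be a real-valued radial neutral Schwartz function on ℝ², let v ∈ ℝ² with |v| < 1 and ω ∈ ℝ. Then the soliton field lies in the energy space: ∫_{ℝ²} |k|² |Â_{v,ω}(k)|² dk < ∞ and ∫_{ℝ²} (v·k)² |Â_{v,ω}(k)|² dk < ∞ (so that A_{v,ω} ∈ Ḣ¹(ℝ²;ℝ²) and Π_{v,ω} = −(v·∇)A_{v,ω} ∈ L²(ℝ²;ℝ²)). -/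
open MeasureTheory
open scoped RealInnerProductSpace BigOperators

noncomputable section

/-- A Schwartz function vanishing at the origin is `O(‖k‖)` near the origin and decays at infinity. -/
theorem SchwartzMap.exists_norm_le_mul_norm_div_of_apply_zero
    {E F : Type*} [NormedAddCommGroup E] [NormedSpace ℝ E]
    [NormedAddCommGroup F] [NormedSpace ℝ F] (G : SchwartzMap E F) (hG : G 0 = 0) :
    ∃ C : ℝ, 0 ≤ C ∧ ∀ k : E, ‖G k‖ ≤ C * ‖k‖ / (1 + ‖k‖) ^ 2 := by
  obtain ⟨C₁, hC₁⟩ := (SchwartzMap.fderivCLM ℝ E F G).decay 0 0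
  obtain ⟨C₂, hC₂⟩ := G.decay 2 0
  simp only [norm_iteratedFDeriv_zero, pow_zero, one_mul, SchwartzMap.fderivCLM_apply] at hC₁ hC₂
  obtain ⟨hC₁0, hC₁⟩ := hC₁
  obtain ⟨hC₂0, hC₂⟩ := hC₂
  have hlin (k : E) : ‖G k‖ ≤ C₁ * ‖k‖ := by
    simpa [hG] using convex_univ.norm_image_sub_le_of_norm_fderiv_le
      (fun x _ ↦ G.differentiableAt) (fun x _ ↦ hC₁ x) (Set.mem_univ 0) (Set.mem_univ k)
  refine ⟨4 * (C₁ + C₂), by linarith, fun k ↦ ?_⟩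
  rw [le_div_iff₀ (by positivity)]
  have hk := norm_nonneg k
  have hGk := norm_nonneg (G k)
  rcases le_total ‖k‖ 1 with h | h
  · calc ‖G k‖ * (1 + ‖k‖) ^ 2 ≤ (C₁ * ‖k‖) * 2 ^ 2 := by gcongr; exacts [hlin k, by linarith]
      _ ≤ 4 * (C₁ + C₂) * ‖k‖ := by nlinarith [mul_nonneg hC₂0.le hk]
  · calc ‖G k‖ * (1 + ‖k‖) ^ 2 ≤ ‖G k‖ * (2 * ‖k‖) ^ 2 := by gcongr; linarith
      _ = 4 * (‖k‖ ^ 2 * ‖G k‖) := by ring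
      _ ≤ 4 * C₂ := by gcongr; exact hC₂ k
      _ ≤ 4 * (C₁ + C₂) * ‖k‖ := by
        nlinarith [mul_nonneg hC₁0.le hk, mul_le_mul_of_nonneg_left h hC₂0.le]

/-- The rescaled Fourier transform `FT` of a Schwartz function is a Schwartz function. -/
theorem exists_schwartzMap_eq_FT (ρ : SchwartzMap V2 ℝ) :
    ∃ G : SchwartzMap V2 ℂ, ⇑G = FT ρ := by
  have hpi : (2 * Real.pi)⁻¹ ≠ 0 := by positivity
  refine ⟨((2 * Real.pi : ℝ) : ℂ)⁻¹ • SchwartzMap.compCLMOfContinuousLinearEquiv ℂ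
    (ContinuousLinearEquiv.smulLeft (Units.mk0 _ hpi))
    (FourierTransform.fourier (SchwartzMap.postcompCLM (𝕜 := ℝ) Complex.ofRealCLM ρ)), ?_⟩
  funext k
  simp only [smul_apply, SchwartzMap.compCLMOfContinuousLinearEquiv_apply,
    Function.comp_apply, SchwartzMap.fourier_coe, Real.fourier_eq', FT, smul_eq_mul]
  congr 1
  refine integral_congr_ae (.of_forall fun x ↦ ?_)
  simp only [SchwartzMap.postcompCLM_apply, Complex.ofRealCLM_apply]
  congr 2
  have : ContinuousLinearEquiv.smulLeft (R₁ := ℝ) (Units.mk0 _ hpi) k = (2 * Real.pi)⁻¹ • k := rfl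
  rw [this, inner_smul_right, real_inner_comm]
  have h : -2 * Real.pi * ((2 * Real.pi)⁻¹ * (⟪k, x⟫ : ℝ)) = -(⟪k, x⟫ : ℝ) := by
    field_simp
  rw [h]
  push_cast
  ring

theorem FT_zero {ρ : V2 → ℝ} (hneu : (∫ x : V2, ρ x) = 0) : FT ρ 0 = 0 := by
  simp [FT, integral_complex_ofReal, hneu]

theorem FT_neg {ρ : V2 → ℝ} (heven : ∀ x, ρ (-x) = ρ x) (k : V2) : FT ρ (-k) = FT ρ k := by
  unfold FT
  rw [← integral_neg_eq_self]
  simp [heven]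

theorem pd_zero_of_even {f : V2 → ℂ} (hf : ∀ k, f (-k) = f k) (j : Fin 2) : pd f j 0 = 0 := by
  have h : pd f j 0 = -pd f j 0 := by
    have := fderiv_comp_smul (𝕜 := ℝ) (f := f) (x := 0) (-1)
    simp only [neg_smul, one_smul, hf, neg_zero] at this
    exact DFunLike.congr_fun this (e2 j)
  exact self_eq_neg.mp h

theorem one_sub_mul_le_Dv (v k : V2) : (1 - ‖v‖ ^ 2) * ‖k‖ ^ 2 ≤ Dv v k := by
  have h : (⟪v, k⟫ : ℝ) ^ 2 ≤ (‖v‖ * ‖k‖) ^ 2 :=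
    sq_le_sq.mpr ((abs_real_inner_le_norm v k).trans (le_abs_self _))
  unfold Dv
  linarith [mul_pow ‖v‖ ‖k‖ 2]

theorem abs_sub_mul_inner_div_le {v : V2} (hv : ‖v‖ ≤ 1) (k : V2) (j : Fin 2) :
    |v j - k j * (⟪v, k⟫ : ℝ) / ‖k‖ ^ 2| ≤ 2 := by
  have h₁ : |v j| ≤ 1 := (PiLp.norm_apply_le v j).trans hv
  have h₂ : |k j * (⟪v, k⟫ : ℝ) / ‖k‖ ^ 2| ≤ 1 := by
    rw [abs_div, abs_mul, abs_of_nonneg (sq_nonneg ‖k‖)]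
    refine div_le_one_of_le₀ ?_ (sq_nonneg _)
    calc |k j| * |(⟪v, k⟫ : ℝ)| ≤ ‖k‖ * (1 * ‖k‖) := by
          gcongr
          · exact PiLp.norm_apply_le k j
          · exact (abs_real_inner_le_norm v k).trans (by gcongr)
      _ = ‖k‖ ^ 2 := by ring
  calc _ ≤ |v j| + |k j * (⟪v, k⟫ : ℝ) / ‖k‖ ^ 2| := abs_sub _ _
    _ ≤ 2 := by linarith

theorem norm_Ahat_le {ρ : V2 → ℝ} {v : V2} (hv : ‖v‖ < 1) (ω : ℝ) {k : V2} (hk : k ≠ 0) {B : ℝ}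
    (hf : ‖FT ρ k‖ ≤ B) (hpd : ∀ j, ‖pd (FT ρ) j k‖ ≤ B) (j : Fin 2) :
    ‖Ahat ρ v ω j k‖ ≤ (2 + |ω|) * B / ((1 - ‖v‖ ^ 2) * ‖k‖ ^ 2) := by
  have hB : 0 ≤ B := (norm_nonneg _).trans hf
  have hc : 0 < 1 - ‖v‖ ^ 2 := by nlinarith [norm_nonneg v]
  have hk' : 0 < ‖k‖ := norm_pos_iff.mpr hk
  have hD := one_sub_mul_le_Dv v k
  have hD0 : 0 < Dv v k := (by positivity : 0 < (1 - ‖v‖ ^ 2) * ‖k‖ ^ 2).trans_le hD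
  have hJ : ‖Jgrad (FT ρ) j k‖ ≤ B := by
    fin_cases j
    · simpa [Jgrad] using hpd 1
    · simpa [Jgrad] using hpd 0
  rw [Ahat, norm_div, Complex.norm_real, Real.norm_of_nonneg hD0.le]
  gcongr
  refine (norm_sub_le _ _).trans ?_
  rw [norm_mul, norm_mul, norm_mul, Complex.norm_I, Complex.norm_real, Complex.norm_real,
    Real.norm_eq_abs, Real.norm_eq_abs, one_mul, add_mul]
  gcongr
  exact abs_sub_mul_inner_div_le hv.le k j

theorem exists_norm_sq_mul_sum_Ahat_le (ρ : SchwartzMap V2 ℝ)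
    (heven : ∀ x, ρ (-x) = ρ x) (hneu : (∫ x : V2, ρ x) = 0)
    {v : V2} (hv : ‖v‖ < 1) (ω : ℝ) :
    ∃ C : ℝ, ∀ k : V2,
      ‖k‖ ^ 2 * ∑ j, ‖Ahat ρ v ω j k‖ ^ 2 ≤ C * (1 + ‖k‖) ^ (-(4 : ℝ)) := by
  obtain ⟨G, hG⟩ := exists_schwartzMap_eq_FT ρ
  have hpd (j : Fin 2) (k : V2) : LineDeriv.lineDerivOp (e2 j) G k = pd (FT ρ) j k := by
    rw [SchwartzMap.lineDerivOp_apply_eq_fderiv, hG, pd]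
  obtain ⟨C₀, hC₀, h₀⟩ := G.exists_norm_le_mul_norm_div_of_apply_zero (by rw [hG, FT_zero hneu])
  choose C₁ hC₁ h₁ using fun j : Fin 2 ↦
    (LineDeriv.lineDerivOp (e2 j) G).exists_norm_le_mul_norm_div_of_apply_zero
      (by rw [hpd, pd_zero_of_even (FT_neg heven)])
  simp only [hpd, hG] at h₀ h₁
  set M := C₀ + ∑ j, C₁ j
  have hM₁ (j : Fin 2) : C₁ j ≤ M :=
    (Finset.single_le_sum (fun i _ ↦ hC₁ i) (Finset.mem_univ j)).trans (le_add_of_nonneg_left hC₀)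
  have hM₀ : C₀ ≤ M := le_add_of_nonneg_right (Finset.sum_nonneg fun i _ ↦ hC₁ i)
  refine ⟨2 * ((2 + |ω|) * M / (1 - ‖v‖ ^ 2)) ^ 2, fun k ↦ ?_⟩
  rcases eq_or_ne k 0 with rfl | hk
  · simp only [norm_zero, ne_eq, OfNat.ofNat_ne_zero, not_false_eq_true, zero_pow, zero_mul]
    positivity
  have hk' : 0 < ‖k‖ := norm_pos_iff.mpr hk
  have hc : 0 < 1 - ‖v‖ ^ 2 := by nlinarith [norm_nonneg v]
  have hA (j : Fin 2) := norm_Ahat_le hv ω hk (B := M * ‖k‖ / (1 + ‖k‖) ^ 2)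
    ((h₀ k).trans (by gcongr)) (fun j ↦ (h₁ j k).trans (by gcongr; exact hM₁ j)) j
  have hrpow : (1 + ‖k‖) ^ (-(4 : ℝ)) = ((1 + ‖k‖) ^ 4)⁻¹ := by
    rw [Real.rpow_neg (by positivity)]
    norm_cast
  rw [hrpow]
  calc ‖k‖ ^ 2 * ∑ j, ‖Ahat ρ v ω j k‖ ^ 2
      ≤ ‖k‖ ^ 2 * ∑ _j : Fin 2,
          ((2 + |ω|) * (M * ‖k‖ / (1 + ‖k‖) ^ 2) / ((1 - ‖v‖ ^ 2) * ‖k‖ ^ 2)) ^ 2 := by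
        gcongr with j
        exact hA j
    _ = 2 * ((2 + |ω|) * M / (1 - ‖v‖ ^ 2)) ^ 2 * ((1 + ‖k‖) ^ 4)⁻¹ := by
        rw [Fin.sum_const, nsmul_eq_mul]
        push_cast
        field_simp

/-- the soliton field lies in the energy space:
`∫ |k|²|Â_{v,ω}(k)|² dk < ∞` and `∫ (v·k)²|Â_{v,ω}(k)|² dk < ∞`. -/
theorem soliton_in_energy_space
    (ρ : SchwartzMap V2 ℝ)
    (hrad : ∀ x y : V2, ‖x‖ = ‖y‖ → ρ x = ρ y)
    (hneu : (∫ x : V2, ρ x) = 0)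
    (v : V2) (hv : ‖v‖ < 1) (ω : ℝ) :
    (∫⁻ k : V2, ENNReal.ofReal (‖k‖ ^ 2 * ∑ j, ‖Ahat (⇑ρ) v ω j k‖ ^ 2) < ⊤)
    ∧ (∫⁻ k : V2, ENNReal.ofReal ((⟪v, k⟫ : ℝ) ^ 2 * ∑ j, ‖Ahat (⇑ρ) v ω j k‖ ^ 2) < ⊤) := by
  obtain ⟨C, hC⟩ := exists_norm_sq_mul_sum_Ahat_le ρ (fun x ↦ hrad _ _ (norm_neg x)) hneu hv ω
  have hint : Integrable (fun k : V2 ↦ C * (1 + ‖k‖) ^ (-(4 : ℝ))) :=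
    (integrable_one_add_norm (by simp; norm_num)).const_mul C
  refine ⟨(lintegral_mono fun k ↦ ENNReal.ofReal_le_ofReal (hC k)).trans_lt hint.lintegral_lt_top,
    (lintegral_mono fun k ↦ ENNReal.ofReal_le_ofReal (le_trans ?_ (hC k))).trans_lt
      hint.lintegral_lt_top⟩
  gcongr ?_ * _
  refine sq_le_sq.mpr ((abs_real_inner_le_norm v k).trans ?_)
  rw [abs_norm]
  exact mul_le_of_le_one_left (norm_nonneg k) hv.le

end
end
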